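/- Assume p̄ = 1/2. Then ν = ν̃ and δ + δ̃ = 1 − 2/ν. -/

import Mathlib

open MeasureTheory Filter Set Matrix ProbabilityTheory
open scoped Classical

noncomputable section

/-- `K` is a (row-)stochastic matrix. -/
def IsStochastic {n : Type*} [Fintype n] (K : Matrix n n ℝ) : Prop :=
  (∀ i j, 0 ≤ K i j) ∧ ∀ i, ∑ j, K i j = 1

/-- `v` is a probability (row) vector. -/
def IsProbVec {n : Type*} [Fintype n] (v : n → ℝ) : Prop :=
  (∀ i, 0 ≤ v i) ∧ ∑ i, v i = 1

/-- `μ` is a stationary distribution for `K`, i.e. `μ K = μ`. -/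
def IsStationaryDist {n : Type*} [Fintype n] (K : Matrix n n ℝ) (μ : n → ℝ) : Prop :=
  IsProbVec μ ∧ Matrix.vecMul μ K = μ

/-- `μ` is the unique stationary distribution of `K` (equivalent, for a finite chain, to `K`
having a unique closed irreducible subset). -/
def HasUniqueStationaryDist {n : Type*} [Fintype n] (K : Matrix n n ℝ) (μ : n → ℝ) : Prop :=
  IsStationaryDist K μ ∧ ∀ μ' : n → ℝ, IsStationaryDist K μ' → μ' = μ

/-- The vector `𝐫 = (I − K + 2(𝟏−𝐩)μD_{1−p}K)⁻¹ 𝐩 − 𝟏` (critical case `p̄ = 1/2`). -/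
def rvec {n : Type*} [Fintype n] [DecidableEq n] (K : Matrix n n ℝ) (μ p : n → ℝ) : n → ℝ :=
  Matrix.mulVec
    (1 - K + (2 : ℝ) •
        Matrix.vecMulVec (fun i => 1 - p i)
          (Matrix.vecMul μ (Matrix.diagonal (fun i => 1 - p i) * K)))⁻¹ p
    - 1

/-- The parameter `ν = 2 + 4 μ D_p K 𝐫` (critical case `p̄ = 1/2`). -/
def nuVal {n : Type*} [Fintype n] [DecidableEq n] (K : Matrix n n ℝ) (μ p : n → ℝ) : ℝ :=
  2 + 4 * ∑ i, Matrix.vecMul μ (Matrix.diagonal p * K) i * rvec K μ p i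

/-- The parameter `δ = 2 (η·𝐫) / ν` (critical case `p̄ = 1/2`). -/
def deltaVal {n : Type*} [Fintype n] [DecidableEq n] (K : Matrix n n ℝ) (μ p η : n → ℝ) : ℝ :=
  2 * (∑ i, η i * rvec K μ p i) / nuVal K μ p

section Helpers

variable {n : Type*} [Fintype n]

lemma IsStochastic.mulVec_one {K : Matrix n n ℝ} (hK : IsStochastic K) : K *ᵥ 1 = 1 := by
  ext i
  simpa [Matrix.mulVec, dotProduct] using hK.2 i

/-- A nonnegative left-invariant vector is a multiple of the unique stationary distribution. -/
lemma HasUniqueStationaryDist.eq_smul_of_nonneg {K : Matrix n n ℝ} {μ w : n → ℝ}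
    (hμ : HasUniqueStationaryDist K μ) (h0 : ∀ i, 0 ≤ w i) (hw : w ᵥ* K = w) :
    w = (∑ i, w i) • μ := by
  rcases eq_or_ne (∑ i, w i) 0 with hs | hs
  · rw [hs, zero_smul]
    ext i
    exact (Finset.sum_eq_zero_iff_of_nonneg fun i _ => h0 i).1 hs i (Finset.mem_univ i)
  · have hdist : IsStationaryDist K ((∑ i, w i)⁻¹ • w) := by
      refine ⟨⟨fun i => ?_, ?_⟩, by rw [Matrix.smul_vecMul, hw]⟩
      · exact mul_nonneg (inv_nonneg.2 (Finset.sum_nonneg fun i _ => h0 i)) (h0 i)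
      · simp only [Pi.smul_apply, smul_eq_mul, ← Finset.mul_sum]
        exact inv_mul_cancel₀ hs
    rw [← hμ.2 _ hdist, smul_smul, mul_inv_cancel₀ hs, one_smul]

/-- The absolute value of a left-invariant vector of a stochastic matrix is left-invariant. -/
lemma IsStochastic.abs_vecMul {K : Matrix n n ℝ} {w : n → ℝ}
    (hK : IsStochastic K) (hw : w ᵥ* K = w) : |w| ᵥ* K = |w| := by
  have hle : ∀ j, |w| j ≤ (|w| ᵥ* K) j := fun j => by
    calc |w| j = |(w ᵥ* K) j| := by rw [hw]; rfl
      _ ≤ ∑ i, |w i * K i j| := Finset.abs_sum_le_sum_abs _ _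
      _ = (|w| ᵥ* K) j := by
        simp only [abs_mul, abs_of_nonneg (hK.1 _ j)]
        rfl
  have hsum : ∑ j, |w| j = ∑ j, (|w| ᵥ* K) j := by
    have h := Matrix.dotProduct_mulVec |w| K 1
    rw [hK.mulVec_one] at h
    simpa [dotProduct] using h
  ext j
  exact ((Finset.sum_eq_sum_iff_of_le fun j _ => hle j).1 hsum j (Finset.mem_univ j)).symm

/-- Every left-invariant vector is a multiple of the unique stationary distribution. -/
lemma HasUniqueStationaryDist.exists_eq_smul {K : Matrix n n ℝ} {μ w : n → ℝ}
    (hK : IsStochastic K) (hμ : HasUniqueStationaryDist K μ) (hw : w ᵥ* K = w) :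
    ∃ c : ℝ, w = c • μ := by
  have habs := hK.abs_vecMul hw
  have h₁ := hμ.eq_smul_of_nonneg (fun i => abs_nonneg (w i)) habs
  have h₂ := hμ.eq_smul_of_nonneg (w := |w| + w)
    (fun i => by have := neg_abs_le (w i); simp; linarith) (by rw [Matrix.add_vecMul, habs, hw])
  refine ⟨(∑ i, (|w| + w) i) - ∑ i, |w i|, ?_⟩
  rw [sub_smul, ← h₂]
  have habs_smul : |w| = (∑ i, |w i|) • μ := h₁
  rw [← habs_smul]
  simp

/-- The Jensen inequality for a stochastic matrix and its stationary distribution. -/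
lemma IsStationaryDist.sum_sq_mulVec_le {K : Matrix n n ℝ} {μ : n → ℝ}
    (hK : IsStochastic K) (hμ : IsStationaryDist K μ) (f : n → ℝ) :
    ∑ i, μ i * (K *ᵥ f) i ^ 2 ≤ ∑ i, μ i * f i ^ 2 := by
  have hJ : ∀ i, (K *ᵥ f) i ^ 2 ≤ (K *ᵥ fun j => f j ^ 2) i := fun i =>
    Real.pow_arith_mean_le_arith_mean_pow_of_even Finset.univ (K i) f
      (fun j _ => hK.1 i j) (hK.2 i) even_two
  calc ∑ i, μ i * (K *ᵥ f) i ^ 2 ≤ μ ⬝ᵥ (K *ᵥ fun j => f j ^ 2) :=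
        Finset.sum_le_sum fun i _ => mul_le_mul_of_nonneg_left (hJ i) (hμ.1.1 i)
    _ = ∑ i, μ i * f i ^ 2 := by rw [Matrix.dotProduct_mulVec, hμ.2]; rfl

lemma dotProduct_one_sub {μ p : n → ℝ} (hμ : IsProbVec μ) (hp : μ ⬝ᵥ p = 1 / 2) :
    μ ⬝ᵥ (fun i => 1 - p i) = 1 / 2 := by
  simp only [dotProduct, mul_sub, Finset.sum_sub_distrib, mul_one, hμ.2] at hp ⊢
  rw [hp]
  norm_num

variable [DecidableEq n]

lemma vecMul_diagonal_mul_dotProduct (K : Matrix n n ℝ) (μ q f : n → ℝ) :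
    (μ ᵥ* (Matrix.diagonal q * K)) ⬝ᵥ f = ∑ i, μ i * q i * (K *ᵥ f) i := by
  rw [← Matrix.vecMul_vecMul, ← Matrix.dotProduct_mulVec]
  simp [dotProduct, Matrix.vecMul_diagonal]

/-- The rank-one perturbation of `1 - K` that is inverted in `rvec`. -/
def perturbedLaplacian (K : Matrix n n ℝ) (μ q : n → ℝ) : Matrix n n ℝ :=
  1 - K + (2 : ℝ) • Matrix.vecMulVec q (μ ᵥ* (Matrix.diagonal q * K))

lemma perturbedLaplacian_mulVec (K : Matrix n n ℝ) (μ q f : n → ℝ) :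
    perturbedLaplacian K μ q *ᵥ f =
      f - K *ᵥ f + (2 * ((μ ᵥ* (Matrix.diagonal q * K)) ⬝ᵥ f)) • q := by
  rw [perturbedLaplacian, Matrix.add_mulVec, Matrix.sub_mulVec, Matrix.one_mulVec,
    Matrix.smul_mulVec, Matrix.vecMulVec_mulVec]
  ext i
  simp
  ring

lemma vecMul_diagonal_mul_dotProduct_one {K : Matrix n n ℝ} {μ q : n → ℝ}
    (hK : IsStochastic K) (hq : μ ⬝ᵥ q = 1 / 2) :
    (μ ᵥ* (Matrix.diagonal q * K)) ⬝ᵥ 1 = 1 / 2 := by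
  rw [vecMul_diagonal_mul_dotProduct, hK.mulVec_one, ← hq]
  simp [dotProduct]

lemma perturbedLaplacian_mulVec_one {K : Matrix n n ℝ} {μ q : n → ℝ}
    (hK : IsStochastic K) (hq : μ ⬝ᵥ q = 1 / 2) :
    perturbedLaplacian K μ q *ᵥ 1 = q := by
  rw [perturbedLaplacian_mulVec, hK.mulVec_one, vecMul_diagonal_mul_dotProduct_one hK hq]
  simp

lemma dotProduct_perturbedLaplacian_mulVec {K : Matrix n n ℝ} {μ q : n → ℝ}
    (hμ : IsStationaryDist K μ) (hq : μ ⬝ᵥ q = 1 / 2) (f : n → ℝ) :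
    μ ⬝ᵥ (perturbedLaplacian K μ q *ᵥ f) = (μ ᵥ* (Matrix.diagonal q * K)) ⬝ᵥ f := by
  rw [perturbedLaplacian_mulVec, dotProduct_add, dotProduct_sub, Matrix.dotProduct_mulVec μ K,
    hμ.2, dotProduct_smul, hq, sub_self, zero_add, smul_eq_mul]
  ring

lemma isUnit_det_perturbedLaplacian {K : Matrix n n ℝ} {μ q : n → ℝ}
    (hK : IsStochastic K) (hμ : HasUniqueStationaryDist K μ) (hq : μ ⬝ᵥ q = 1 / 2) :
    IsUnit (perturbedLaplacian K μ q).det := by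
  rw [isUnit_iff_ne_zero]
  intro hdet
  obtain ⟨y, hy0, hy⟩ := Matrix.exists_vecMul_eq_zero_iff.2 hdet
  have hpair : ∀ f, y ⬝ᵥ (perturbedLaplacian K μ q *ᵥ f) = 0 := fun f => by
    rw [Matrix.dotProduct_mulVec, hy, zero_dotProduct]
  have hyq : y ⬝ᵥ q = 0 := by
    simpa [perturbedLaplacian_mulVec_one hK hq] using hpair 1
  have hinv : y ᵥ* K = y := by
    refine dotProduct_eq _ _ fun f => ?_
    have h := hpair f
    rw [perturbedLaplacian_mulVec, dotProduct_add, dotProduct_sub, dotProduct_smul, hyq,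
      Matrix.dotProduct_mulVec] at h
    simp at h
    linarith
  obtain ⟨c, rfl⟩ := hμ.exists_eq_smul hK hinv
  rw [smul_dotProduct, hq, smul_eq_mul] at hyq
  have hc : c = 0 := by linarith
  exact hy0 (by simp [hc])

/-- The right-invariant vectors are the constants. -/
lemma HasUniqueStationaryDist.exists_eq_smul_one {K : Matrix n n ℝ} {μ f : n → ℝ}
    (hK : IsStochastic K) (hμ : HasUniqueStationaryDist K μ) (hf : K *ᵥ f = f) :
    ∃ c : ℝ, f = c • 1 := by
  have hq : μ ⬝ᵥ (fun _ => (1 / 2 : ℝ)) = 1 / 2 := by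
    simp [dotProduct, ← Finset.sum_mul, hμ.1.1.2]
  set q : n → ℝ := fun _ => 1 / 2
  refine ⟨2 * ((μ ᵥ* (Matrix.diagonal q * K)) ⬝ᵥ f), ?_⟩
  have hinj := Matrix.mulVec_injective_of_isUnit
    ((Matrix.isUnit_iff_isUnit_det _).2 (isUnit_det_perturbedLaplacian hK hμ hq))
  apply hinj
  rw [Matrix.mulVec_smul, perturbedLaplacian_mulVec_one hK hq, perturbedLaplacian_mulVec, hf,
    sub_self, zero_add]

/-- In the critical case `rvec` solves the Poisson equation with right-hand side `2p - 1`,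
normalised by `μ D_{1-p} K 𝐫 = 0`. -/
lemma rvec_poisson {K : Matrix n n ℝ} {μ p : n → ℝ}
    (hK : IsStochastic K) (hμ : HasUniqueStationaryDist K μ) (hp : μ ⬝ᵥ p = 1 / 2) :
    (μ ᵥ* (Matrix.diagonal (fun i => 1 - p i) * K)) ⬝ᵥ rvec K μ p = 0 ∧
      rvec K μ p - K *ᵥ rvec K μ p = fun i => 2 * p i - 1 := by
  have hq := dotProduct_one_sub hμ.1.1 hp
  have hA : perturbedLaplacian K μ (fun i => 1 - p i) *ᵥ rvec K μ p = p - fun i => 1 - p i := by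
    change _ *ᵥ ((perturbedLaplacian K μ fun i => 1 - p i)⁻¹ *ᵥ p - 1) = _
    rw [Matrix.mulVec_sub, perturbedLaplacian_mulVec_one hK hq, Matrix.mulVec_mulVec,
      Matrix.mul_nonsing_inv _ (isUnit_det_perturbedLaplacian hK hμ hq), Matrix.one_mulVec]
  have h0 : (μ ᵥ* (Matrix.diagonal (fun i => 1 - p i) * K)) ⬝ᵥ rvec K μ p = 0 := by
    rw [← dotProduct_perturbedLaplacian_mulVec hμ.1 hq, hA, dotProduct_sub, hp, hq, sub_self]
  refine ⟨h0, ?_⟩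
  rw [perturbedLaplacian_mulVec, h0, mul_zero, zero_smul, add_zero] at hA
  rw [hA]
  ext i
  simp only [Pi.sub_apply]
  ring

lemma nuVal_pos {K : Matrix n n ℝ} {μ p : n → ℝ}
    (hK : IsStochastic K) (hμ : HasUniqueStationaryDist K μ)
    (hp : ∀ i, p i ∈ Set.Ioo (0 : ℝ) 1) (hcrit : μ ⬝ᵥ p = 1 / 2) :
    0 < nuVal K μ p := by
  obtain ⟨h0, hr⟩ := rvec_poisson hK hμ hcrit
  have hν : nuVal K μ p = 2 + 4 * ((μ ᵥ* (Matrix.diagonal p * K)) ⬝ᵥ rvec K μ p) := rfl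
  rw [hν]
  rw [vecMul_diagonal_mul_dotProduct] at h0 ⊢
  have hJ := hμ.1.sum_sq_mulVec_le hK (rvec K μ p)
  set r := rvec K μ p
  set s := K *ᵥ r
  have hri : ∀ i, r i = s i + (2 * p i - 1) := fun i => by
    have := congrFun hr i
    simp only [Pi.sub_apply] at this
    linarith
  have hexp : ∑ i, μ i * r i ^ 2 = ∑ i, μ i * s i ^ 2 + 2 * ∑ i, μ i * p i * s i
      - 2 * ∑ i, μ i * (1 - p i) * s i + ∑ i, μ i * (2 * p i - 1) ^ 2 := by
    simp only [Finset.mul_sum, ← Finset.sum_add_distrib, ← Finset.sum_sub_distrib]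
    refine Finset.sum_congr rfl fun i _ => ?_
    rw [hri i]
    ring
  have hlt : ∑ i, μ i * (2 * p i - 1) ^ 2 < 1 := by
    have hsq : ∀ i, (2 * p i - 1) ^ 2 < 1 := fun i => by
      nlinarith [mul_pos (hp i).1 (sub_pos.2 (hp i).2)]
    obtain ⟨i, -, hi⟩ : ∃ i ∈ Finset.univ, 0 < μ i := by
      refine Finset.exists_lt_of_sum_lt ?_
      simp [hμ.1.1.2]
    refine lt_of_lt_of_eq ?_ hμ.1.1.2
    exact Finset.sum_lt_sum
      (fun j _ => mul_le_of_le_one_right (hμ.1.1.1 j) (hsq j).le)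
      ⟨i, Finset.mem_univ i, mul_lt_of_lt_one_right hi (hsq i)⟩
  linarith

/-- In the critical case `𝐫 + 𝐫̃` is constant, and the constant determines `ν = ν̃`. -/
lemma exists_rvec_add_rvec_one_sub {K : Matrix n n ℝ} {μ p : n → ℝ}
    (hK : IsStochastic K) (hμ : HasUniqueStationaryDist K μ) (hcrit : μ ⬝ᵥ p = 1 / 2) :
    ∃ c : ℝ, rvec K μ p + rvec K μ (fun i => 1 - p i) = c • 1 ∧
      nuVal K μ p = 2 + 2 * c ∧ nuVal K μ (fun i => 1 - p i) = 2 + 2 * c := by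
  have hq := dotProduct_one_sub hμ.1.1 hcrit
  obtain ⟨h0, hr⟩ := rvec_poisson hK hμ hcrit
  obtain ⟨h0', hr'⟩ := rvec_poisson hK hμ hq
  simp only [sub_sub_cancel] at h0'
  have hinv : K *ᵥ (rvec K μ p + rvec K μ fun i => 1 - p i) =
      rvec K μ p + rvec K μ fun i => 1 - p i := by
    rw [Matrix.mulVec_add]
    ext i
    have h := congrFun hr i
    have h' := congrFun hr' i
    simp only [Pi.sub_apply, Pi.add_apply] at h h' ⊢
    linarith
  obtain ⟨c, hc⟩ := hμ.exists_eq_smul_one hK hinv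
  refine ⟨c, hc, ?_, ?_⟩
  · have h := congrArg (dotProduct (μ ᵥ* (Matrix.diagonal p * K))) hc
    rw [dotProduct_add, h0', dotProduct_smul, vecMul_diagonal_mul_dotProduct_one hK hcrit,
      smul_eq_mul] at h
    change 2 + 4 * ((μ ᵥ* (Matrix.diagonal p * K)) ⬝ᵥ rvec K μ p) = _
    linarith
  · have h := congrArg (dotProduct (μ ᵥ* (Matrix.diagonal (fun i => 1 - p i) * K))) hc
    rw [dotProduct_add, h0, dotProduct_smul, vecMul_diagonal_mul_dotProduct_one hK hq,
      smul_eq_mul] at h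
    change 2 + 4 * ((μ ᵥ* (Matrix.diagonal (fun i => 1 - p i) * K)) ⬝ᵥ
      rvec K μ (fun i => 1 - p i)) = _
    linarith

end Helpers

/-- **Proposition 4.3.** In the critical case `p̄ = 1/2` one has `ν = ν̃` and
`δ + δ̃ = 1 − 2/ν` (where `ν̃ = nuVal K μ (1−p)` and `δ̃ = deltaVal K μ (1−p) η`). -/
theorem nu_eq_nutil_and_delta_sum
    {N : ℕ} (K : Matrix (Fin N) (Fin N) ℝ) (μ p η : Fin N → ℝ)
    (hK : IsStochastic K) (hμ : HasUniqueStationaryDist K μ)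
    (hp : ∀ i, p i ∈ Set.Ioo (0 : ℝ) 1) (hη : IsProbVec η)
    (hcrit : ∑ i, μ i * p i = 1 / 2) :
    nuVal K μ p = nuVal K μ (fun i => 1 - p i) ∧
    deltaVal K μ p η + deltaVal K μ (fun i => 1 - p i) η = 1 - 2 / nuVal K μ p := by
  obtain ⟨c, hc, hν, hν'⟩ := exists_rvec_add_rvec_one_sub hK hμ hcrit
  have hpos := nuVal_pos hK hμ hp hcrit
  refine ⟨hν.trans hν'.symm, ?_⟩
  have hsum : ∑ i, η i * rvec K μ p i + ∑ i, η i * rvec K μ (fun i => 1 - p i) i = c := by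
    have h := congrArg (dotProduct η) hc
    rw [dotProduct_add, dotProduct_smul, dotProduct_one, hη.2, smul_eq_mul, mul_one] at h
    exact h
  rw [deltaVal, deltaVal, hν', ← hν, ← add_div, ← mul_add, hsum]
  field_simp
  linarith

end
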